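/- Let r_H(λ, μ) = E(η̂_H(μ+z, λ) − μ)² with z ~ N(0,1), where η̂_H(x,λ) = x·1{|x| > λ}. Then as λ → ∞, the supremum of the risk over nonnegative means satisfies sup over μ ≥ 0 of r_H(λ, μ) = λ² − 2√2·λ√(log λ) + o(λ√(log λ)); that is, (sup_{μ≥0} r_H(λ,μ) − λ² + 2√2·λ√(log λ)) / (λ√(log λ)) → 0 as λ → ∞. -/

import Mathlib

open MeasureTheory ProbabilityTheory Filter
open scoped ENNReal NNReal Topology

noncomputable section

/-- One-dimensional hard thresholding risk
`r_H(λ, μ) = E(η̂_H(μ+z,λ) − μ)²`, `z ~ N(0,1)`, where `η̂_H(x,λ) = x·1{|x|>λ}`. -/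
def rH (lam μ : ℝ) : ℝ :=
  ∫ z, ((if lam < |μ + z| then μ + z else 0) - μ) ^ 2 ∂(gaussianReal 0 1)

lemma aux_sq_int : Integrable (fun z : ℝ => z ^ 2) (gaussianReal 0 1) := by
  have h := memLp_id_gaussianReal (μ := 0) (v := 1) 2
  exact h.integrable_sq

lemma aux_sq : ∫ z, z ^ 2 ∂(gaussianReal 0 1) = 1 := by
  have h := variance_of_integral_eq_zero (X := fun x : ℝ => x) (μ := gaussianReal 0 1)
    (by fun_prop) (by simp)
  rw [variance_fun_id_gaussianReal] at h
  simpa using h.symm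

lemma aux_f_int (lam μ : ℝ) : Integrable
    (fun z : ℝ => ((if lam < |μ + z| then μ + z else 0) - μ) ^ 2) (gaussianReal 0 1) := by
  refine Integrable.mono' (aux_sq_int.add (integrable_const (μ ^ 2))) ?_ ?_
  · apply Measurable.aestronglyMeasurable
    refine Measurable.pow_const (Measurable.sub_const (Measurable.ite ?_ ?_ ?_) _) _
    · exact measurableSet_lt measurable_const (by fun_prop)
    · fun_prop
    · fun_prop
  · refine ae_of_all _ fun z => ?_
    simp only [Pi.add_apply, Real.norm_eq_abs, abs_pow, sq_abs]
    split_ifs <;> nlinarith [sq_nonneg z, sq_nonneg μ]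

lemma aux_upper1 (lam μ : ℝ) : rH lam μ ≤ 1 + μ ^ 2 := by
  have : ∫ z, (z ^ 2 + μ ^ 2) ∂(gaussianReal 0 1) = 1 + μ ^ 2 := by
    rw [integral_add aux_sq_int (integrable_const _), aux_sq]; simp
  rw [← this]
  refine integral_mono (aux_f_int lam μ) (aux_sq_int.add (integrable_const _)) fun z => ?_
  dsimp only
  split_ifs <;> nlinarith [sq_nonneg z, sq_nonneg μ]

lemma aux_upper2 (lam μ t : ℝ) (hl : 0 ≤ lam) (hμ : 0 ≤ μ) (ht : lam - t ≤ μ) :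
    rH lam μ ≤ 2 * lam + 2 + lam ^ 2 * (gaussianReal 0 1).real (Set.Iic t) := by
  have hi : Integrable ((Set.Iic t).indicator (fun _ : ℝ => lam ^ 2)) (gaussianReal 0 1) :=
    (integrable_const _).indicator measurableSet_Iic
  have h1 : Integrable (fun z : ℝ => (lam + 2) * z ^ 2) (gaussianReal 0 1) :=
    aux_sq_int.const_mul _
  have h2 : Integrable (fun z : ℝ => (lam + 2) * z ^ 2 + lam) (gaussianReal 0 1) :=
    h1.add (integrable_const _)
  have : ∫ z, (((lam + 2) * z ^ 2 + lam) + (Set.Iic t).indicator (fun _ : ℝ => lam ^ 2) z)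
      ∂(gaussianReal 0 1) = 2 * lam + 2 + lam ^ 2 * (gaussianReal 0 1).real (Set.Iic t) := by
    rw [integral_add h2 hi, integral_add h1 (integrable_const _), integral_const_mul, aux_sq,
      integral_indicator_const _ measurableSet_Iic]
    simp; ring
  rw [← this]
  refine integral_mono (aux_f_int lam μ) (h2.add hi) fun z => ?_
  dsimp only
  by_cases hz : lam < |μ + z|
  · have : 0 ≤ (Set.Iic t).indicator (fun _ : ℝ => lam ^ 2) z :=
      Set.indicator_nonneg (fun _ _ => sq_nonneg _) _
    rw [if_pos hz]
    nlinarith [sq_nonneg z, mul_nonneg hl (sq_nonneg z)]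
  · rw [if_neg hz]
    push Not at hz
    have h3 := abs_le.1 hz
    rw [Set.indicator_of_mem (by simp only [Set.mem_Iic]; linarith)]
    have h4 : μ ≤ lam + |z| := by
      have := neg_abs_le z
      linarith
    have h5 : μ ^ 2 ≤ (lam + |z|) ^ 2 := by gcongr
    have h6 : |z| ^ 2 = z ^ 2 := sq_abs z
    nlinarith [mul_nonneg hl (sq_nonneg (|z| - 1)), sq_nonneg z]

lemma aux_lower (lam t : ℝ) (hl : t ≤ lam) :
    (lam - t) ^ 2 * (gaussianReal 0 1).real (Set.Icc (-t) t) ≤ rH lam (lam - t) := by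
  have : ∫ z, (Set.Icc (-t) t).indicator (fun _ : ℝ => (lam - t) ^ 2) z ∂(gaussianReal 0 1)
      = (lam - t) ^ 2 * (gaussianReal 0 1).real (Set.Icc (-t) t) := by
    rw [integral_indicator_const _ measurableSet_Icc]; simp [mul_comm]
  rw [← this]
  refine integral_mono ((integrable_const _).indicator measurableSet_Icc)
    (aux_f_int lam _) fun z => ?_
  dsimp only
  by_cases hz : z ∈ Set.Icc (-t) t
  · have hz' := hz
    rw [Set.indicator_of_mem hz, if_neg]
    · exact le_of_eq (by ring)
    · push Not
      rw [abs_le]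
      constructor <;> linarith [hz'.1, hz'.2]
  · rw [Set.indicator_of_notMem hz]
    positivity

lemma aux_ge (t : ℝ) (ht : 0 ≤ t) :
    (gaussianReal 0 1).real {z | t ≤ z} ≤ Real.exp (-t ^ 2 / 2) := by
  have h := measure_ge_le_exp_mul_mgf (X := id) (μ := gaussianReal 0 1) t ht
    (integrable_exp_mul_gaussianReal t)
  rw [mgf_id_gaussianReal, ← Real.exp_add] at h
  refine h.trans (le_of_eq ?_)
  congr 1
  simp; ring

lemma aux_le (t : ℝ) (ht : 0 ≤ t) :
    (gaussianReal 0 1).real {z | z ≤ -t} ≤ Real.exp (-t ^ 2 / 2) := by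
  have h := measure_le_le_exp_mul_mgf (X := id) (μ := gaussianReal 0 1) (-t)
    (neg_nonpos.2 ht) (integrable_exp_mul_gaussianReal (-t))
  rw [mgf_id_gaussianReal, ← Real.exp_add] at h
  refine h.trans (le_of_eq ?_)
  congr 1
  simp; ring

lemma aux_Icc (t : ℝ) (ht : 0 ≤ t) :
    1 - 2 * Real.exp (-t ^ 2 / 2) ≤ (gaussianReal 0 1).real (Set.Icc (-t) t) := by
  have h1 := probReal_compl_eq_one_sub (μ := gaussianReal 0 1)
    (measurableSet_Icc (a := -t) (b := t))
  have h2 : (gaussianReal 0 1).real (Set.Icc (-t) t)ᶜ ≤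
      (gaussianReal 0 1).real ({z | z ≤ -t} ∪ {z | t ≤ z}) := by
    apply measureReal_mono
    · intro z hz
      by_contra h
      simp only [Set.mem_union, Set.mem_ofPred_eq, not_or, not_le] at h
      exact hz ⟨h.1.le, h.2.le⟩
    · exact measure_ne_top _ _
  have h3 := measureReal_union_le (μ := gaussianReal 0 1) {z : ℝ | z ≤ -t} {z | t ≤ z}
  linarith [aux_ge t ht, aux_le t ht]

lemma aux_tail (t : ℝ) (ht : 0 ≤ t) :
    (gaussianReal 0 1).real (Set.Iic t) ≤ 1 - Real.exp (-(t + 1) ^ 2 / 2) / 3 := by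
  have h1 := probReal_compl_eq_one_sub (μ := gaussianReal 0 1)
    (measurableSet_Iic (a := t))
  have h2 : (gaussianReal 0 1).real (Set.Ioc t (t + 1)) ≤
      (gaussianReal 0 1).real (Set.Iic t)ᶜ := by
    apply measureReal_mono
    · intro z hz
      simpa using hz.1
    · exact measure_ne_top _ _
  have h3 : Real.exp (-(t + 1) ^ 2 / 2) / 3 ≤ (gaussianReal 0 1).real (Set.Ioc t (t + 1)) := by
    rw [measureReal_def, gaussianReal_apply_eq_integral _ one_ne_zero, ENNReal.toReal_ofReal
      (setIntegral_nonneg measurableSet_Ioc fun x _ => gaussianPDFReal_nonneg _ _ _)]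
    have h4 : ∫ x in Set.Ioc t (t + 1), (Real.exp (-(t + 1) ^ 2 / 2) / 3 : ℝ) =
        Real.exp (-(t + 1) ^ 2 / 2) / 3 := by
      simp
    rw [← h4]
    refine setIntegral_mono_on (by simp) (integrable_gaussianPDFReal _ _).integrableOn
      measurableSet_Ioc fun x hx => ?_
    rw [gaussianPDFReal, div_eq_inv_mul]
    have h5 : √(2 * Real.pi * (1 : ℝ≥0)) ≤ 3 := by
      rw [Real.sqrt_le_left (by norm_num)]
      have := Real.pi_lt_four
      simp; linarith
    have h6 : 0 < √(2 * Real.pi * (1 : ℝ≥0)) := by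
      apply Real.sqrt_pos.2
      simp [Real.pi_pos]
    apply mul_le_mul
    · exact inv_anti₀ h6 h5
    · apply Real.exp_le_exp.2
      simp only [sub_zero, NNReal.coe_one, mul_one]
      have := hx.1
      have := hx.2
      have : x ^ 2 ≤ (t + 1) ^ 2 := by
        apply pow_le_pow_left₀ <;> linarith
      linarith
    · positivity
    · positivity
  linarith

lemma aux_core (s lam : ℝ) (hs : 20 ≤ s) (hlam : lam = Real.exp (s ^ 2)) :
    lam ^ 2 - 2 * √2 * lam * s - 2 * lam ≤ sSup ((fun μ => rH lam μ) '' Set.Ici 0) ∧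
    sSup ((fun μ => rH lam μ) '' Set.Ici 0) ≤ lam ^ 2 - 2 * √2 * lam * s + 10 * lam := by
  have q2 : √2 ^ 2 = 2 := Real.sq_sqrt (by norm_num)
  have q1 : √2 ≤ 1.5 := by
    rw [Real.sqrt_le_left (by norm_num)]; norm_num
  have q0 : 1 ≤ √2 := by
    rw [Real.one_le_sqrt]; norm_num
  have hbig : 1 + s ^ 2 + (s ^ 2) ^ 2 / 2 ≤ lam := by
    rw [hlam]; exact Real.quadratic_le_exp_of_nonneg (sq_nonneg s)
  have hs2 : 400 ≤ s ^ 2 := by nlinarith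
  have hlam1 : 2 * s ^ 2 ≤ lam := by nlinarith
  have hlam0 : 0 < lam := by linarith
  have hub : ∀ μ ∈ Set.Ici (0 : ℝ), rH lam μ ≤ lam ^ 2 - 2 * √2 * lam * s + 10 * lam := by
    intro μ hμ
    have hμ : 0 ≤ μ := hμ
    set t := √2 * (s - 1) - 1 with ht
    have ht0 : 0 ≤ t := by nlinarith
    by_cases h : lam - t ≤ μ
    · have h1 := aux_upper2 lam μ t hlam0.le hμ h
      have h2 := aux_tail t ht0
      have h3 : Real.exp (-(t + 1) ^ 2 / 2) * lam = Real.exp (2 * s - 1) := by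
        rw [hlam, ← Real.exp_add]
        congr 1
        rw [ht]
        have : (√2 * (s - 1) - 1 + 1) ^ 2 = √2 ^ 2 * (s - 1) ^ 2 := by ring
        rw [neg_div, this, q2]; ring
      have h4 := Real.quadratic_le_exp_of_nonneg (x := 2 * s - 1) (by linarith)
      have h5 : 9 * s ≤ Real.exp (2 * s - 1) := by nlinarith
      have h6 : lam ^ 2 * (gaussianReal 0 1).real (Set.Iic t) ≤
          lam ^ 2 - lam * Real.exp (2 * s - 1) / 3 := by
        calc _ ≤ lam ^ 2 * (1 - Real.exp (-(t + 1) ^ 2 / 2) / 3) := by gcongr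
          _ = _ := by rw [← h3]; ring
      have h7 : lam * (9 * s) ≤ lam * Real.exp (2 * s - 1) := by gcongr
      have h8 : √2 * (lam * s) ≤ 1.5 * (lam * s) := by gcongr
      nlinarith
    · push Not at h
      have h1 := aux_upper1 lam μ
      have h2 : μ ^ 2 ≤ (lam - t) ^ 2 := by gcongr
      have h3 : t ≤ √2 * s := by nlinarith
      have h4 : t ^ 2 ≤ (√2 * s) ^ 2 := by gcongr
      rw [mul_pow, q2] at h4
      have h5 : (lam - t) ^ 2 = lam ^ 2 - 2 * √2 * lam * s + 2 * √2 * lam + 2 * lam + t ^ 2 := by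
        rw [ht]; ring
      have h8 : √2 * lam ≤ 1.5 * lam := by gcongr
      nlinarith
  constructor
  · have hst : √2 * s ≤ lam := by nlinarith
    have h1 := aux_lower lam (√2 * s) hst
    have h2 := aux_Icc (√2 * s) (by positivity)
    have h3 : Real.exp (-(√2 * s) ^ 2 / 2) * lam = 1 := by
      rw [hlam, ← Real.exp_add, mul_pow, q2]
      rw [Real.exp_eq_one_iff]; ring
    have h4 : rH lam (lam - √2 * s) ≤ sSup ((fun μ => rH lam μ) '' Set.Ici 0) := by
      apply le_csSup
      · refine ⟨lam ^ 2 - 2 * √2 * lam * s + 10 * lam, ?_⟩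
        rintro _ ⟨μ, hμ, rfl⟩
        exact hub μ hμ
      · exact ⟨_, by simpa using hst, rfl⟩
    refine le_trans ?_ (h1.trans h4)
    have h5 : (lam - √2 * s) ^ 2 * (1 - 2 * Real.exp (-(√2 * s) ^ 2 / 2)) ≤
      (lam - √2 * s) ^ 2 * (gaussianReal 0 1).real (Set.Icc (-(√2 * s)) (√2 * s)) := by gcongr
    refine le_trans ?_ h5
    set e := Real.exp (-(√2 * s) ^ 2 / 2) with he
    have he0 : 0 < e := Real.exp_pos _
    have h6 : (lam - √2 * s) ^ 2 * e ≤ lam ^ 2 * e := by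
      have : 0 ≤ √2 * s := by positivity
      gcongr
      linarith
    have h7 : lam ^ 2 * e = lam := by
      calc _ = lam * (e * lam) := by ring
        _ = lam := by rw [h3, mul_one]
    nlinarith [sq_nonneg (√2 * s)]
  · apply csSup_le (Set.image_nonempty.2 ⟨0, by simp⟩)
    rintro _ ⟨μ, hμ, rfl⟩
    exact hub μ hμ

/-- Lemma `lem::sup-risk-hard-threshold`: as `λ → ∞`,
`sup_{μ ≥ 0} r_H(λ, μ) = λ² − 2√2·λ√(log λ) + o(λ√(log λ))`. -/
theorem statement19 :
    Tendsto
      (fun lam : ℝ =>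
        (sSup ((fun μ => rH lam μ) '' Set.Ici 0) - lam ^ 2 +
            2 * Real.sqrt 2 * lam * Real.sqrt (Real.log lam)) /
          (lam * Real.sqrt (Real.log lam)))
      atTop (𝓝 0) := by
  have hs : Tendsto (fun lam : ℝ => √(Real.log lam)) atTop atTop :=
    Real.tendsto_sqrt_atTop.comp Real.tendsto_log_atTop
  have hlim : Tendsto (fun lam : ℝ => 10 / √(Real.log lam)) atTop (𝓝 0) :=
    hs.const_div_atTop 10
  refine squeeze_zero_norm' ?_ hlim
  filter_upwards [hs.eventually_ge_atTop 20, eventually_gt_atTop 1] with lam h20 h1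
  have hlog : 0 ≤ Real.log lam := Real.log_nonneg h1.le
  have hc := aux_core (√(Real.log lam)) lam h20
    (by rw [Real.sq_sqrt hlog, Real.exp_log (by linarith)])
  have hs0 : 0 < √(Real.log lam) := by linarith
  rw [Real.norm_eq_abs, abs_div, abs_of_pos (a := lam * _) (by positivity),
    div_le_div_iff₀ (by positivity) hs0]
  have : |sSup ((fun μ => rH lam μ) '' Set.Ici 0) - lam ^ 2 +
            2 * Real.sqrt 2 * lam * Real.sqrt (Real.log lam)| ≤ 10 * lam := by
    rw [abs_le]
    constructor <;> linarith [hc.1, hc.2]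
  calc _ ≤ 10 * lam * √(Real.log lam) := by gcongr
    _ = _ := by ring
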